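/- Let u be an ancient solution of the heat equation on ℝⁿ with polynomial growth of degree at most q ≥ 1, i.e. |u(x,t)| ≤ c₀(|x| + √|t| + 1)^q for all x ∈ ℝⁿ, t ≤ 0. Let k be the least integer strictly greater than q/2. Then there exist smooth functions u_0, u_1, …, u_{k-1} : ℝⁿ → ℝ such that u(x,t) = u_0(x) + u_1(x) t + ⋯ + u_{k-1}(x) t^{k-1} for all x ∈ ℝⁿ and t ≤ 0, with Δu_i = (i+1) u_{i+1} for i = 0, …, k−2 and Δu_{k-1} = 0 (u_{k-1} is harmonic). -/

import Mathlib

open MeasureTheory Real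

noncomputable section

/-- Spatial Laplacian of `f : ℝⁿ → ℝ` at `x` (sum of second partial derivatives). -/
def lap (n : ℕ) (f : EuclideanSpace ℝ (Fin n) → ℝ) (x : EuclideanSpace ℝ (Fin n)) : ℝ :=
  ∑ i : Fin n, fderiv ℝ (fun y => fderiv ℝ f y (EuclideanSpace.single i 1)) x
    (EuclideanSpace.single i 1)

/-- `u` is a smooth ancient solution of the heat equation on `ℝⁿ × (-∞, 0]`:
it is smooth and satisfies `Δ_x u = ∂_t u` for all `t ≤ 0`. -/
def IsAncientHeat (n : ℕ) (u : EuclideanSpace ℝ (Fin n) × ℝ → ℝ) : Prop :=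
  ContDiff ℝ (⊤ : ℕ∞) u ∧ ∀ (x : EuclideanSpace ℝ (Fin n)) (t : ℝ), t ≤ 0 →
    lap n (fun y => u (y, t)) x = deriv (fun s => u (x, s)) t

open Filter Topology

/-- The directional derivative of `f` in the direction `v`. -/
def dirDeriv {F : Type*} [NormedAddCommGroup F] [NormedSpace ℝ F] (v : F) (f : F → ℝ) : F → ℝ :=
  fun p => fderiv ℝ f p v

section DirDeriv

variable {F : Type*} [NormedAddCommGroup F] [NormedSpace ℝ F] {f : F → ℝ}

theorem ContDiff.dirDeriv (hf : ContDiff ℝ (⊤ : ℕ∞) f) (v : F) :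
    ContDiff ℝ (⊤ : ℕ∞) (dirDeriv v f) :=
  (hf.fderiv_right (m := (⊤ : ℕ∞)) (by norm_cast)).clm_apply contDiff_const

theorem ContDiff.differentiable_of_smooth (hf : ContDiff ℝ (⊤ : ℕ∞) f) : Differentiable ℝ f :=
  hf.differentiable (by simp)

theorem dirDeriv_comm (hf : ContDiff ℝ (⊤ : ℕ∞) f) (v w : F) :
    dirDeriv v (dirDeriv w f) = dirDeriv w (dirDeriv v f) := by
  have hd : Differentiable ℝ (fderiv ℝ f) :=
    (hf.fderiv_right (m := (⊤ : ℕ∞)) (by norm_cast)).differentiable (by simp)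
  have key : ∀ (v w p : F), dirDeriv v (dirDeriv w f) p = fderiv ℝ (fderiv ℝ f) p v w := by
    intro v w p
    have h : HasFDerivAt (dirDeriv w f) ((fderiv ℝ (fderiv ℝ f) p).flip w) p := by
      have h := (hd p).hasFDerivAt.clm_apply (hasFDerivAt_const w p)
      rw [ContinuousLinearMap.comp_zero, zero_add] at h
      exact h
    simp [dirDeriv, h.fderiv]
  funext p
  rw [key, key]
  exact second_derivative_symmetric (fun y => (hf.differentiable_of_smooth y).hasFDerivAt)
    (hd p).hasFDerivAt v w

theorem hasDerivAt_line (hf : ContDiff ℝ (⊤ : ℕ∞) f) (p v : F) (s : ℝ) :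
    HasDerivAt (fun s : ℝ => f (p + s • v)) (dirDeriv v f (p + s • v)) s := by
  have h : HasDerivAt (fun s : ℝ => p + s • v) v s := by
    simpa using ((hasDerivAt_id s).smul_const v).const_add p
  exact (hf.differentiable_of_smooth _).hasFDerivAt.comp_hasDerivAt s h

end DirDeriv

theorem second_deriv_nonpos_of_isLocalMax {φ φ' : ℝ → ℝ} {φ'' x : ℝ}
    (h1 : ∀ s, HasDerivAt φ (φ' s) s) (h2 : HasDerivAt φ' φ'' x) (hmax : IsLocalMax φ x) :
    φ'' ≤ 0 := by
  by_contra! hpos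
  have hd : deriv φ = φ' := funext fun s => (h1 s).deriv
  have hmin : IsLocalMin φ x := by
    refine isLocalMin_of_deriv_deriv_pos ?_ hmax.deriv_eq_zero (h1 x).continuousAt
    rwa [hd, h2.deriv]
  have hconst : φ =ᶠ[𝓝 x] fun _ => φ x := by
    filter_upwards [hmax, hmin] with s ha hb using le_antisymm ha hb
  have hzero : φ' =ᶠ[𝓝 x] fun _ => 0 := by
    rw [← hd]
    simpa using hconst.deriv
  have := hzero.deriv_eq
  rw [h2.deriv] at this
  simp at this
  linarith

theorem deriv_nonneg_of_eventually_le_left {φ : ℝ → ℝ} {φ' x : ℝ} (h : HasDerivAt φ φ' x)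
    (hmax : ∀ᶠ s in 𝓝[<] x, φ s ≤ φ x) : 0 ≤ φ' := by
  have := (h.tendsto_slope).mono_left 
    (nhdsWithin_mono x (fun s (hs : s ∈ Set.Iio x) => ne_of_lt hs : Set.Iio x ⊆ {x}ᶜ))
  refine ge_of_tendsto this ?_
  filter_upwards [hmax, self_mem_nhdsWithin] with s hs hlt
  rw [slope_def_field]
  exact div_nonneg_of_nonpos (by linarith) (by simpa using le_of_lt hlt)

theorem Polynomial.natDegree_le_of_growth {P : Polynomial ℝ} (hP : P ≠ 0) {b c q : ℝ}
    (hb : 0 ≤ b) (hq : 0 ≤ q) (hc : 0 ≤ c)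
    (h : ∀ s : ℝ, 0 ≤ s → |P.eval s| ≤ c * (b + s) ^ q) : (P.natDegree : ℝ) ≤ q := by
  by_contra! hlt
  have hlim := Polynomial.div_tendsto_atTop_leadingCoeff_div_of_degree_eq P
    (Polynomial.X ^ P.natDegree) (by rw [Polynomial.degree_X_pow, Polynomial.degree_eq_natDegree hP])
  have hzero : Tendsto (fun s : ℝ => c * 2 ^ q * s ^ (-((P.natDegree : ℝ) - q))) atTop (𝓝 0) := by
    simpa using (tendsto_rpow_neg_atTop (sub_pos.2 hlt)).const_mul (c * 2 ^ q)
  have := squeeze_zero_norm' (f := fun s => Polynomial.eval s P /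
    Polynomial.eval s (Polynomial.X ^ P.natDegree)) ?_ hzero
  · have := tendsto_nhds_unique hlim this
    simp [hP] at this
  · filter_upwards [eventually_ge_atTop b, eventually_gt_atTop 0] with s hs hs0
    have h1 := h s hs0.le
    have h2 : (b + s) ^ q ≤ 2 ^ q * s ^ q := by
      rw [← Real.mul_rpow (by norm_num) hs0.le]
      exact Real.rpow_le_rpow (by linarith) (by linarith) hq
    rw [neg_sub, Real.rpow_sub hs0, Real.rpow_natCast]
    simp only [Polynomial.eval_pow, Polynomial.eval_X, norm_div, norm_pow, Real.norm_eq_abs,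
      abs_of_pos hs0]
    rw [← mul_div_assoc]
    gcongr
    nlinarith

theorem coeff_eq_zero_of_growth {N : ℕ} {a : ℕ → ℝ} {b c q : ℝ}
    (hb : 0 ≤ b) (hq : 0 ≤ q) (hc : 0 ≤ c)
    (h : ∀ t : ℝ, t ≤ 0 → |∑ i ∈ Finset.range N, a i * t ^ i| ≤ c * (b + √|t|) ^ q)
    {i : ℕ} (hi : q / 2 < i) (hiN : i < N) : a i = 0 := by
  set P : Polynomial ℝ := ∑ i ∈ Finset.range N,
    Polynomial.C (a i * (-1) ^ i) * Polynomial.X ^ (2 * i) with hPdef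
  have hcoeff : P.coeff (2 * i) = a i * (-1) ^ i := by
    rw [hPdef, Polynomial.finsetSum_coeff]
    simp only [Polynomial.coeff_C_mul, Polynomial.coeff_X_pow]
    rw [Finset.sum_eq_single i]
    · simp
    · intro j _ hj
      simp [hj.symm]
    · simp [hiN]
  have hgrowth : ∀ s : ℝ, 0 ≤ s → |P.eval s| ≤ c * (b + s) ^ q := by
    intro s hs
    have h1 := h (-s ^ 2) (by nlinarith)
    rw [abs_neg, abs_of_nonneg (sq_nonneg s), Real.sqrt_sq hs] at h1
    convert h1 using 2
    rw [hPdef, Polynomial.eval_finsetSum]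
    refine Finset.sum_congr rfl fun j _ => ?_
    simp only [Polynomial.eval_mul, Polynomial.eval_C, Polynomial.eval_pow, Polynomial.eval_X]
    rw [neg_pow (s ^ 2), pow_mul]
    ring
  have hz : P.coeff (2 * i) = 0 := by
    by_cases hP : P = 0
    · simp [hP]
    · apply Polynomial.coeff_eq_zero_of_natDegree_lt
      have h1 := Polynomial.natDegree_le_of_growth hP hb hq hc hgrowth
      have h2 : (P.natDegree : ℝ) < ((2 * i : ℕ) : ℝ) := by push_cast; linarith
      exact_mod_cast h2
  rw [hcoeff] at hz
  simpa using hz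

variable {n : ℕ} {u : EuclideanSpace ℝ (Fin n) × ℝ → ℝ}

/-- The `i`-th spatial coordinate direction in space-time. -/
def spaceDir (i : Fin n) : EuclideanSpace ℝ (Fin n) × ℝ := (EuclideanSpace.single i 1, 0)

/-- The time direction in space-time. -/
def timeDir (n : ℕ) : EuclideanSpace ℝ (Fin n) × ℝ := (0, 1)

theorem lap_slice (hu : ContDiff ℝ (⊤ : ℕ∞) u) (x : EuclideanSpace ℝ (Fin n)) (t : ℝ) :
    lap n (fun y => u (y, t)) x = ∑ i, dirDeriv (spaceDir i) (dirDeriv (spaceDir i) u) (x, t) := by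
  have key : ∀ {f : EuclideanSpace ℝ (Fin n) × ℝ → ℝ}, ContDiff ℝ (⊤ : ℕ∞) f → ∀ y i,
      fderiv ℝ (fun y => f (y, t)) y (EuclideanSpace.single i 1) =
        dirDeriv (spaceDir i) f (y, t) := by
    intro f hf y i
    have h := HasFDerivAt.comp (g := f) (f := fun e => (e, t)) y
      (hf.differentiable_of_smooth (y, t)).hasFDerivAt (hasFDerivAt_prodMk_left y t)
    have h' : fderiv ℝ (fun y => f (y, t)) y = _ :=
      h.fderiv
    rw [h']
    simp [dirDeriv, spaceDir]
  unfold lap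
  refine Finset.sum_congr rfl fun i _ => ?_
  simp_rw [key hu]
  exact key (hu.dirDeriv _) x i

theorem hasDerivAt_time (hu : ContDiff ℝ (⊤ : ℕ∞) u) (x : EuclideanSpace ℝ (Fin n)) (t : ℝ) :
    HasDerivAt (fun s => u (x, s)) (dirDeriv (timeDir n) u (x, t)) t := by
  simpa [timeDir] using hasDerivAt_line hu (x, 0) (timeDir n) t

namespace IsAncientHeat

theorem sum_dirDeriv (hu : IsAncientHeat n u) {p : EuclideanSpace ℝ (Fin n) × ℝ} (hp : p.2 ≤ 0) :
    ∑ i, _root_.dirDeriv (spaceDir i) (_root_.dirDeriv (spaceDir i) u) p =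
      _root_.dirDeriv (timeDir n) u p := by
  have := hu.2 p.1 p.2 hp
  rwa [lap_slice hu.1, (hasDerivAt_time hu.1 p.1 p.2).deriv] at this

theorem dirDeriv (hu : IsAncientHeat n u) (v : EuclideanSpace ℝ (Fin n) × ℝ) :
    IsAncientHeat n (dirDeriv v u) := by
  refine ⟨hu.1.dirDeriv v, fun x t ht => ?_⟩
  rw [lap_slice (hu.1.dirDeriv v), (hasDerivAt_time (hu.1.dirDeriv v) x t).deriv]
  simp_rw [fun i => dirDeriv_comm hu.1 (spaceDir i) v,
    fun i => dirDeriv_comm (hu.1.dirDeriv (spaceDir i)) (spaceDir i) v]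
  rw [dirDeriv_comm hu.1 (timeDir n) v]
  set S : Set (EuclideanSpace ℝ (Fin n) × ℝ) := {p | p.2 ≤ 0} with hS
  have hconv : Convex ℝ S := (convex_Iic (0 : ℝ)).linear_preimage
    (LinearMap.snd ℝ (EuclideanSpace ℝ (Fin n)) ℝ)
  have hint : (interior S).Nonempty := by
    refine ⟨(0, -1), mem_interior.2 ⟨{p | p.2 < 0}, fun p (hp : p.2 < 0) => hp.le, ?_, ?_⟩⟩
    · exact isOpen_lt continuous_snd continuous_const
    · simp
  have hmem : ((x, t) : EuclideanSpace ℝ (Fin n) × ℝ) ∈ S := ht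
  have huniq : UniqueDiffWithinAt ℝ S (x, t) :=
    uniqueDiffWithinAt_convex hconv hint (subset_closure hmem)
  have hL : HasFDerivAt (fun p => ∑ i, _root_.dirDeriv (spaceDir i)
      (_root_.dirDeriv (spaceDir i) u) p)
      (∑ i, fderiv ℝ (_root_.dirDeriv (spaceDir i) (_root_.dirDeriv (spaceDir i) u)) (x, t))
      (x, t) :=
    HasFDerivAt.fun_sum fun i _ => (((hu.1.dirDeriv (spaceDir i)).dirDeriv
      (spaceDir i)).differentiable_of_smooth _).hasFDerivAt
  have hT := ((hu.1.dirDeriv (timeDir n)).differentiable_of_smooth (x, t)).hasFDerivAt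
  have := huniq.eq hL.hasFDerivWithinAt (hT.hasFDerivWithinAt.congr
    (fun p (hp : p.2 ≤ 0) => hu.sum_dirDeriv hp) (hu.sum_dirDeriv hmem))
  simpa [_root_.dirDeriv] using congrArg (fun L => L v) this

end IsAncientHeat

theorem eq_sum_of_iterate_timeDeriv_eq_zero (N : ℕ) (hu : ContDiff ℝ (⊤ : ℕ∞) u)
    (h : ∀ p, p.2 ≤ 0 → (dirDeriv (timeDir n))^[N] u p = 0)
    (x : EuclideanSpace ℝ (Fin n)) {t : ℝ} (ht : t ≤ 0) :
    u (x, t) = ∑ i ∈ Finset.range N,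
      (dirDeriv (timeDir n))^[i] u (x, 0) / (i.factorial : ℝ) * t ^ i := by
  induction N generalizing u t with
  | zero => simpa using h (x, t) ht
  | succ N ih =>
    have hderiv : ∀ s ≤ 0, HasDerivAt (fun s => u (x, s) - ∑ i ∈ Finset.range (N + 1),
        (dirDeriv (timeDir n))^[i] u (x, 0) / (i.factorial : ℝ) * s ^ i) 0 s := by
      intro s hs
      have h1 := hasDerivAt_time hu x s
      have h2 : HasDerivAt (fun s : ℝ => ∑ i ∈ Finset.range (N + 1),
          (dirDeriv (timeDir n))^[i] u (x, 0) / (i.factorial : ℝ) * s ^ i)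
          (∑ i ∈ Finset.range (N + 1),
          (dirDeriv (timeDir n))^[i] u (x, 0) / (i.factorial : ℝ) * (i * s ^ (i - 1))) s :=
        HasDerivAt.fun_sum fun i _ => (hasDerivAt_pow i s).const_mul _
      have h3 := h1.sub h2
      suffices he : dirDeriv (timeDir n) u (x, s) = ∑ i ∈ Finset.range (N + 1),
          (dirDeriv (timeDir n))^[i] u (x, 0) / (i.factorial : ℝ) * (i * s ^ (i - 1)) by
        rwa [sub_eq_zero.2 he] at h3
      rw [ih (hu.dirDeriv _) (fun p hp => h p hp) hs, Finset.sum_range_succ']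
      simp only [Nat.cast_zero, zero_mul, mul_zero, add_zero]
      refine Finset.sum_congr rfl fun i _ => ?_
      rw [← Function.iterate_succ_apply, Nat.factorial_succ]
      have : (i.factorial : ℝ) ≠ 0 := by positivity
      have : (i : ℝ) + 1 ≠ 0 := by positivity
      push_cast
      field_simp
    have hconst := (convex_Iic (0 : ℝ)).is_const_of_fderivWithin_eq_zero (𝕜 := ℝ)
      (fun s hs => (hderiv s hs).differentiableAt.differentiableWithinAt)
      (fun s hs => by
        rw [(hderiv s hs).hasFDerivAt.hasFDerivWithinAt.fderivWithin
          (uniqueDiffOn_Iic 0 s hs)]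
        ext; simp) (Set.mem_Iic.2 ht) (Set.mem_Iic.2 le_rfl)
    rw [Finset.sum_range_succ' _ N] at hconst
    rw [Finset.sum_range_succ' _ N]
    simp [Finset.sum_range_succ'] at hconst ⊢
    linarith

theorem norm_add_smul_single_sq (x : EuclideanSpace ℝ (Fin n)) (i : Fin n) (s : ℝ) :
    ‖x + s • EuclideanSpace.single i (1 : ℝ)‖ ^ 2 = ‖x‖ ^ 2 + 2 * s * x i + s ^ 2 := by
  rw [norm_add_sq_real, norm_smul, inner_smul_right, EuclideanSpace.inner_single_right]
  simp
  ring

/-- Second derivative test for the quantity `h² g² + A f²` of Bernstein's method, where the cutoff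
`h` is quadratic. -/
theorem second_deriv_bernstein {f f' g g' : ℝ → ℝ} {f'' g'' h₀ a A : ℝ}
    (hf : ∀ s, HasDerivAt f (f' s) s) (hf' : HasDerivAt f' f'' 0)
    (hg : ∀ s, HasDerivAt g (g' s) s) (hg' : HasDerivAt g' g'' 0)
    (hmax : IsLocalMax (fun s => (h₀ - 2 * a * s - s ^ 2) ^ 2 * g s ^ 2 + A * f s ^ 2) 0) :
    -(4 * h₀ + 24 * a ^ 2) * g 0 ^ 2 + 2 * h₀ ^ 2 * g 0 * g'' + 2 * A * f' 0 ^ 2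
      + 2 * A * f 0 * f'' ≤ 0 := by
  have hh : ∀ s, HasDerivAt (fun s : ℝ => h₀ - 2 * a * s - s ^ 2) (-2 * a - 2 * s) s := by
    intro s
    refine ((((hasDerivAt_id s).const_mul (2 * a)).const_sub h₀).sub
      (hasDerivAt_pow 2 s)).congr_deriv ?_
    simp
  have hh' : HasDerivAt (fun s : ℝ => -2 * a - 2 * s) (-2) 0 := by
    simpa using ((hasDerivAt_id (0 : ℝ)).const_mul 2).const_sub (-2 * a)
  have h1 : ∀ s, HasDerivAt
      (fun s => (h₀ - 2 * a * s - s ^ 2) ^ 2 * g s ^ 2 + A * f s ^ 2)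
      (2 * (h₀ - 2 * a * s - s ^ 2) * (-2 * a - 2 * s) * g s ^ 2 +
        (h₀ - 2 * a * s - s ^ 2) ^ 2 * (2 * g s * g' s) + A * (2 * f s * f' s)) s := by
    intro s
    have := (((hh s).fun_pow 2).fun_mul ((hg s).fun_pow 2)).fun_add
      (((hf s).fun_pow 2).const_mul A)
    refine this.congr_deriv ?_
    simp
  have h2 := ((((hh 0).const_mul 2).fun_mul hh').fun_mul ((hg 0).fun_pow 2)).fun_add
    ((((hh 0).fun_pow 2).fun_mul (((hg 0).const_mul 2).fun_mul hg'))) |>.fun_add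
    ((((hf 0).const_mul 2).fun_mul hf').const_mul A)
  have := second_deriv_nonpos_of_isLocalMax h1 h2 hmax
  norm_num at this
  nlinarith [sq_nonneg (h₀ * g' 0 - 4 * a * g 0)]

theorem IsAncientHeat.gradient_estimate (hu : IsAncientHeat n u)
    {x₀ : EuclideanSpace ℝ (Fin n)} {t₀ r M : ℝ} (ht₀ : t₀ ≤ 0) (hr : 0 < r)
    (hM : ∀ x t, ‖x - x₀‖ ≤ r → t₀ - r ^ 2 ≤ t → t ≤ t₀ → |u (x, t)| ≤ M) (j : Fin n) :
    r * |_root_.dirDeriv (spaceDir j) u (x₀, t₀)| ≤ √(2 * n + 14) * M := by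
  set v := _root_.dirDeriv (spaceDir j) u with hv
  have hvheat : IsAncientHeat n v := hu.dirDeriv _
  have hM0 : 0 ≤ M := (abs_nonneg _).trans (hM x₀ t₀ (by simpa using hr.le) (by nlinarith) le_rfl)
  set η : EuclideanSpace ℝ (Fin n) × ℝ → ℝ := fun p => r ^ 2 - ‖p.1 - x₀‖ ^ 2 + (p.2 - t₀) with hη
  set A : ℝ := (2 * n + 14) * r ^ 2 with hA
  have hA0 : 0 < A := by positivity
  set W : EuclideanSpace ℝ (Fin n) × ℝ → ℝ := fun p => η p ^ 2 * v p ^ 2 + A * u p ^ 2 with hW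
  have hηc : Continuous η := by fun_prop
  have huc : Continuous u := hu.1.continuous
  have hvc : Continuous v := hvheat.1.continuous
  have hWc : Continuous W := by fun_prop
  set K : Set (EuclideanSpace ℝ (Fin n) × ℝ) := {p | p.2 ≤ t₀ ∧ 0 ≤ η p} with hK
  have hKbound : ∀ p ∈ K, ‖p.1 - x₀‖ ^ 2 ≤ r ^ 2 ∧ t₀ - r ^ 2 ≤ p.2 ∧ η p ≤ r ^ 2 := by
    rintro p ⟨h1, h2⟩
    simp only [hη] at h2 ⊢
    have := sq_nonneg ‖p.1 - x₀‖
    exact ⟨by linarith, by linarith, by linarith⟩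
  have hKM : ∀ p ∈ K, u p ^ 2 ≤ M ^ 2 := by
    intro p hp
    obtain ⟨h1, h2, -⟩ := hKbound p hp
    exact sq_le_sq' (abs_le.1 (hM p.1 p.2 (by nlinarith [norm_nonneg (p.1 - x₀)]) h2 hp.1)).1
      (abs_le.1 (hM p.1 p.2 (by nlinarith [norm_nonneg (p.1 - x₀)]) h2 hp.1)).2
  have hKc : IsCompact K := by
    refine ((isCompact_closedBall x₀ r).prod
      (isCompact_Icc (a := t₀ - r ^ 2) (b := t₀))).of_isClosed_subset
      ((isClosed_le continuous_snd continuous_const).inter (isClosed_le continuous_const hηc)) ?_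
    intro p hp
    obtain ⟨h1, h2, -⟩ := hKbound p hp
    refine ⟨?_, h2, hp.1⟩
    rw [mem_closedBall_iff_norm]
    nlinarith [norm_nonneg (p.1 - x₀)]
  have hmem : ((x₀, t₀) : EuclideanSpace ℝ (Fin n) × ℝ) ∈ K :=
    ⟨le_rfl, by simp only [hη]; simp; positivity⟩
  obtain ⟨p, hpK, hpmax⟩ := hKc.exists_isMaxOn ⟨_, hmem⟩ hWc.continuousOn
  have hWp : W p ≤ A * M ^ 2 := by
    have hsimple : η p ^ 2 * v p ^ 2 = 0 → W p ≤ A * M ^ 2 := by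
      intro h0
      simp only [hW, h0, zero_add]
      exact mul_le_mul_of_nonneg_left (hKM p hpK) hA0.le
    by_cases hη0 : η p = 0
    · exact hsimple (by simp [hη0])
    by_cases hv0 : v p = 0
    · exact hsimple (by simp [hv0])
    exfalso
    have hηpos : 0 < η p := lt_of_le_of_ne hpK.2 (Ne.symm hη0)
    have hp0 : p.2 ≤ 0 := hpK.1.trans ht₀
    have hline : ∀ d : EuclideanSpace ℝ (Fin n) × ℝ, ∀ᶠ s : ℝ in 𝓝 0, 0 < η (p + s • d) := by
      intro d
      have hc : Continuous fun s : ℝ => η (p + s • d) := by fun_prop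
      exact hc.continuousAt.eventually (lt_mem_nhds (by simpa using hηpos))
    have hspace : ∀ i : Fin n, -(4 * η p + 24 * (p.1 - x₀) i ^ 2) * v p ^ 2
        + 2 * η p ^ 2 * v p * _root_.dirDeriv (spaceDir i) (_root_.dirDeriv (spaceDir i) v) p
        + 2 * A * _root_.dirDeriv (spaceDir i) u p ^ 2
        + 2 * A * u p * _root_.dirDeriv (spaceDir i) (_root_.dirDeriv (spaceDir i) u) p ≤ 0 := by
      intro i
      have hηs : ∀ s : ℝ, η (p + s • spaceDir i) = η p - 2 * (p.1 - x₀) i * s - s ^ 2 := by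
        intro s
        have := norm_add_smul_single_sq (p.1 - x₀) i s
        simp only [hη, spaceDir, Prod.fst_add, Prod.smul_fst, Prod.snd_add, Prod.smul_snd]
        rw [add_sub_right_comm, this]
        simp
        ring
      have hmax : IsLocalMax (fun s : ℝ => (η p - 2 * (p.1 - x₀) i * s - s ^ 2) ^ 2 *
          v (p + s • spaceDir i) ^ 2 + A * u (p + s • spaceDir i) ^ 2) 0 := by
        filter_upwards [hline (spaceDir i)] with s hs
        have := hpmax (a := p + s • spaceDir i) ⟨by simpa [spaceDir] using hpK.1, hs.le⟩
        simpa [hW, hηs] using this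
      simpa using second_deriv_bernstein (fun s => hasDerivAt_line hu.1 p (spaceDir i) s)
        (hasDerivAt_line (hu.1.dirDeriv (spaceDir i)) p (spaceDir i) 0)
        (fun s => hasDerivAt_line hvheat.1 p (spaceDir i) s)
        (hasDerivAt_line (hvheat.1.dirDeriv (spaceDir i)) p (spaceDir i) 0) hmax
    have htime : 0 ≤ 2 * η p * v p ^ 2 + η p ^ 2 * (2 * v p * _root_.dirDeriv (timeDir n) v p)
        + A * (2 * u p * _root_.dirDeriv (timeDir n) u p) := by
      have hηs : ∀ s : ℝ, η (p + s • timeDir n) = η p + s := by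
        intro s
        simp [hη, timeDir]
        ring
      have hh : HasDerivAt (fun s : ℝ => η p + s) 1 0 := (hasDerivAt_id (0 : ℝ)).const_add _
      have hd := ((hh.fun_pow 2).fun_mul
        ((hasDerivAt_line hvheat.1 p (timeDir n) 0).fun_pow 2)).fun_add
        (((hasDerivAt_line hu.1 p (timeDir n) 0).fun_pow 2).const_mul A)
      have := deriv_nonneg_of_eventually_le_left hd ?_
      · simpa using this
      · filter_upwards [(hline (timeDir n)).filter_mono nhdsWithin_le_nhds,
          self_mem_nhdsWithin] with s hs hs0
        have hs0 : s < 0 := hs0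
        have := hpmax (a := p + s • timeDir n) ⟨by simp [timeDir]; linarith [hpK.1], hs.le⟩
        simpa [hW, hηs] using this
    have hsum := Finset.sum_nonpos fun i (_ : i ∈ Finset.univ) => hspace i
    simp only [Finset.sum_add_distrib, ← Finset.mul_sum, ← Finset.sum_mul,
      Finset.sum_neg_distrib, Finset.sum_const, Finset.card_univ, Fintype.card_fin,
      hu.sum_dirDeriv hp0, hvheat.sum_dirDeriv hp0, ← EuclideanSpace.real_norm_sq_eq,
      nsmul_eq_mul] at hsum
    have hj : v p ^ 2 ≤ ∑ i, _root_.dirDeriv (spaceDir i) u p ^ 2 :=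
      Finset.single_le_sum (f := fun i => _root_.dirDeriv (spaceDir i) u p ^ 2)
        (fun i _ => sq_nonneg _) (Finset.mem_univ j)
    obtain ⟨h1, -, h3⟩ := hKbound p hpK
    have hvpos : 0 < v p ^ 2 := by positivity
    have hAj := mul_le_mul_of_nonneg_left hj hA0.le
    have hfin : 2 * A * v p ^ 2 ≤
        ((4 * n + 2) * η p + 24 * ‖p.1 - x₀‖ ^ 2) * v p ^ 2 := by
      linarith
    have hlt : (4 * n + 2) * η p + 24 * ‖p.1 - x₀‖ ^ 2 < 2 * A := by
      have := mul_le_mul_of_nonneg_left h3 (by positivity : (0 : ℝ) ≤ 4 * n + 2)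
      have : 0 < r ^ 2 := by positivity
      rw [hA]
      linarith
    exact absurd (le_of_mul_le_mul_right hfin hvpos) (not_le.2 hlt)
  have h0 : W (x₀, t₀) ≤ A * M ^ 2 := (hpmax hmem).trans hWp
  have h1 : r ^ 2 * (r * |v (x₀, t₀)|) ^ 2 ≤ r ^ 2 * ((2 * n + 14) * M ^ 2) := by
    have hηx : η (x₀, t₀) = r ^ 2 := by simp [hη]
    have : 0 ≤ A * u (x₀, t₀) ^ 2 := by positivity
    simp only [hW, hηx, hA] at h0 this
    rw [mul_pow, sq_abs]
    linarith
  have h2 := le_of_mul_le_mul_left h1 (by positivity)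
  rw [← Real.sqrt_sq hM0, ← Real.sqrt_mul (by positivity)]
  exact Real.le_sqrt_of_sq_le h2

/-- Polynomial growth of degree at most `m` on `ℝⁿ × (-∞, 0]`, in the parabolic scaling. -/
def HasParabolicGrowth (m : ℕ) (u : EuclideanSpace ℝ (Fin n) × ℝ → ℝ) : Prop :=
  ∃ C : ℝ, 0 ≤ C ∧ ∀ p, p.2 ≤ 0 → |u p| ≤ C * (‖p.1‖ + √|p.2| + 1) ^ m

namespace HasParabolicGrowth

theorem congr {m : ℕ} {v : EuclideanSpace ℝ (Fin n) × ℝ → ℝ} (hv : HasParabolicGrowth m v)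
    (h : ∀ p, p.2 ≤ 0 → v p = u p) : HasParabolicGrowth m u := by
  obtain ⟨C, hC, hb⟩ := hv
  exact ⟨C, hC, fun p hp => h p hp ▸ hb p hp⟩

theorem mono {m m' : ℕ} (hu : HasParabolicGrowth m u) (h : m ≤ m') : HasParabolicGrowth m' u := by
  obtain ⟨C, hC, hb⟩ := hu
  refine ⟨C, hC, fun p hp => (hb p hp).trans ?_⟩
  gcongr
  linarith [norm_nonneg p.1, Real.sqrt_nonneg |p.2|]

theorem sum {m : ℕ} {ι : Type*} (s : Finset ι) {f : ι → EuclideanSpace ℝ (Fin n) × ℝ → ℝ}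
    (hf : ∀ i, HasParabolicGrowth m (f i)) :
    HasParabolicGrowth m (fun p => ∑ i ∈ s, f i p) := by
  choose C hC hb using hf
  refine ⟨∑ i ∈ s, C i, Finset.sum_nonneg fun i _ => hC i, fun p hp => ?_⟩
  rw [Finset.sum_mul]
  exact (Finset.abs_sum_le_sum_abs _ _).trans (Finset.sum_le_sum fun i _ => hb i p hp)

theorem dirDeriv_spaceDir {m : ℕ} (hg : HasParabolicGrowth m u) (hu : IsAncientHeat n u)
    (j : Fin n) : HasParabolicGrowth (m - 1) (dirDeriv (spaceDir j) u) := by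
  obtain ⟨C, hC, hb⟩ := hg
  refine ⟨√(2 * n + 14) * (C * 3 ^ m), by positivity, fun p hp => ?_⟩
  set R := ‖p.1‖ + √|p.2| + 1 with hR
  have hR1 : 1 ≤ R := by linarith [norm_nonneg p.1, Real.sqrt_nonneg |p.2|]
  have hR0 : 0 < R := by linarith
  have key := hu.gradient_estimate (x₀ := p.1) (t₀ := p.2) (r := R) (M := C * (3 * R) ^ m) hp hR0
    (fun x t hx ht1 ht2 => (hb (x, t) (ht2.trans hp)).trans ?_) j
  · have h1 : R ^ m ≤ R * R ^ (m - 1) := by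
      rw [← pow_succ']
      exact pow_le_pow_right₀ hR1 (by omega)
    refine le_of_mul_le_mul_left (key.trans ?_) hR0
    calc √(2 * n + 14) * (C * (3 * R) ^ m) = √(2 * n + 14) * (C * 3 ^ m) * R ^ m := by
          rw [mul_pow]; ring
      _ ≤ √(2 * n + 14) * (C * 3 ^ m) * (R * R ^ (m - 1)) := by gcongr
      _ = _ := by ring
  · have hx' : ‖x‖ ≤ R + ‖p.1‖ := by
      have := norm_add_le (x - p.1) p.1
      rw [sub_add_cancel] at this
      linarith
    have ht' : √|t| ≤ √|p.2| + R := by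
      rw [Real.sqrt_le_left (by positivity), abs_of_nonpos (ht2.trans hp)]
      have := Real.sq_sqrt (abs_nonneg p.2)
      rw [abs_of_nonpos hp] at this ⊢
      nlinarith [mul_nonneg (Real.sqrt_nonneg (-p.2)) hR0.le]
    dsimp only
    gcongr
    linarith

theorem dirDeriv_spaceDir_eq_zero (hg : HasParabolicGrowth 0 u) (hu : IsAncientHeat n u)
    (j : Fin n) {p : EuclideanSpace ℝ (Fin n) × ℝ} (hp : p.2 ≤ 0) :
    dirDeriv (spaceDir j) u p = 0 := by
  obtain ⟨C, hC, hb⟩ := hg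
  have key : ∀ r : ℝ, 0 < r → r * |dirDeriv (spaceDir j) u p| ≤ √(2 * n + 14) * C := fun r hr =>
    hu.gradient_estimate (x₀ := p.1) (t₀ := p.2) hp hr
      (fun x t _ _ ht => by simpa using hb (x, t) (ht.trans hp)) j
  by_contra hne
  have hpos : 0 < |dirDeriv (spaceDir j) u p| := abs_pos.2 hne
  have := key ((√(2 * n + 14) * C + 1) / |dirDeriv (spaceDir j) u p|) (by positivity)
  rw [div_mul_cancel₀ _ hpos.ne'] at this
  linarith

theorem dirDeriv_timeDir {m : ℕ} (hg : HasParabolicGrowth (m + 1) u) (hu : IsAncientHeat n u) :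
    HasParabolicGrowth m (dirDeriv (timeDir n) u) :=
  congr (sum Finset.univ fun i =>
    ((hg.dirDeriv_spaceDir hu i).dirDeriv_spaceDir (hu.dirDeriv _) i).mono (by omega))
    fun _ hp => hu.sum_dirDeriv hp

theorem iterate_timeDeriv_eq_zero {m : ℕ} (hg : HasParabolicGrowth m u) (hu : IsAncientHeat n u)
    {p : EuclideanSpace ℝ (Fin n) × ℝ} (hp : p.2 ≤ 0) :
    (dirDeriv (timeDir n))^[m + 1] u p = 0 := by
  induction m generalizing u with
  | zero =>
    rw [zero_add, Function.iterate_one, ← hu.sum_dirDeriv hp]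
    exact Finset.sum_eq_zero fun i _ =>
      (hg.dirDeriv_spaceDir hu i).dirDeriv_spaceDir_eq_zero (hu.dirDeriv _) i hp
  | succ m ih => exact ih (hg.dirDeriv_timeDir hu) (hu.dirDeriv _)

end HasParabolicGrowth

theorem IsAncientHeat.iterate_timeDeriv (hu : IsAncientHeat n u) (i : ℕ) :
    IsAncientHeat n ((_root_.dirDeriv (timeDir n))^[i] u) := by
  induction i with
  | zero => exact hu
  | succ i ih =>
    rw [Function.iterate_succ_apply']
    exact ih.dirDeriv _

theorem lap_div_const (f : EuclideanSpace ℝ (Fin n) → ℝ) (hf : ContDiff ℝ (⊤ : ℕ∞) f) (c : ℝ)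
    (x : EuclideanSpace ℝ (Fin n)) : lap n (fun y => f y / c) x = lap n f x / c := by
  simp only [lap, div_eq_mul_inv, Finset.sum_mul]
  refine Finset.sum_congr rfl fun i _ => ?_
  have h1 : ∀ {g : EuclideanSpace ℝ (Fin n) → ℝ}, ContDiff ℝ (⊤ : ℕ∞) g → ∀ y v,
      fderiv ℝ (fun y => g y * c⁻¹) y v = fderiv ℝ g y v * c⁻¹ := by
    intro g hg y v
    rw [fderiv_mul_const (hg.differentiable_of_smooth y)]
    simp [mul_comm]
  simp_rw [h1 hf]
  exact h1 (hf.dirDeriv _) x _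

/-- an ancient solution of the heat equation on `ℝⁿ × (-∞,0]` of
polynomial growth of degree at most `q ≥ 1` is a polynomial in time:
`u(x,t) = u₀(x) + u₁(x) t + ⋯ + u_{k-1}(x) t^{k-1}` where `k` is the least integer
with `k > q/2`, `Δ u_i = (i+1) u_{i+1}` for `i ≤ k−2`, and `u_{k-1}` is harmonic. -/
theorem ancient_poly_growth_is_time_polynomial (n : ℕ) (q c₀ : ℝ)
    (hq : 1 ≤ q) (hc₀ : 0 < c₀)
    (u : EuclideanSpace ℝ (Fin n) × ℝ → ℝ)
    (hu : IsAncientHeat n u)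
    (hgr : ∀ (x : EuclideanSpace ℝ (Fin n)) (t : ℝ), t ≤ 0 →
      |u (x, t)| ≤ c₀ * (‖x‖ + Real.sqrt |t| + 1) ^ q)
    (k : ℕ) (hk₁ : q / 2 < (k : ℝ)) (hk₂ : (k : ℝ) - 1 ≤ q / 2) :
    ∃ v : ℕ → EuclideanSpace ℝ (Fin n) → ℝ,
      (∀ i, ContDiff ℝ (⊤ : ℕ∞) (v i)) ∧
      (∀ (x : EuclideanSpace ℝ (Fin n)) (t : ℝ), t ≤ 0 →
        u (x, t) = ∑ i ∈ Finset.range k, v i x * t ^ i) ∧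
      (∀ i : ℕ, i + 1 < k → ∀ x, lap n (v i) x = ((i : ℝ) + 1) * v (i + 1) x) ∧
      (∀ x, lap n (v (k - 1)) x = 0) := by
  have hq2 : 0 < q / 2 := by linarith
  have hk : 0 < k := by exact_mod_cast hq2.trans hk₁
  obtain ⟨m, hm⟩ := exists_nat_ge q
  set D : ℕ → EuclideanSpace ℝ (Fin n) × ℝ → ℝ := fun i => (dirDeriv (timeDir n))^[i] u with hD
  have hDheat : ∀ i, IsAncientHeat n (D i) := hu.iterate_timeDeriv
  have hslice : ∀ i, ContDiff ℝ (⊤ : ℕ∞) fun x : EuclideanSpace ℝ (Fin n) => D i (x, 0) :=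
    fun i => (hDheat i).1.comp (contDiff_id.prodMk contDiff_const)
  have hgrowth : HasParabolicGrowth (m + k) u := by
    refine ⟨c₀, hc₀.le, fun p hp => (hgr p.1 p.2 hp).trans ?_⟩
    rw [← Real.rpow_natCast]
    have h1 : 1 ≤ ‖p.1‖ + √|p.2| + 1 := by linarith [norm_nonneg p.1, Real.sqrt_nonneg |p.2|]
    refine mul_le_mul_of_nonneg_left (Real.rpow_le_rpow_of_exponent_le h1 ?_) hc₀.le
    push_cast
    linarith
  have hexp : ∀ x t, t ≤ 0 → u (x, t) = ∑ i ∈ Finset.range (m + k + 1),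
      D i (x, 0) / (i.factorial : ℝ) * t ^ i := fun x t ht =>
    eq_sum_of_iterate_timeDeriv_eq_zero _ hu.1
      (fun p hp => hgrowth.iterate_timeDeriv_eq_zero hu hp) x ht
  have hzero : ∀ x i, k ≤ i → i < m + k + 1 → D i (x, 0) / (i.factorial : ℝ) = 0 := by
    intro x i hki hi
    refine coeff_eq_zero_of_growth (a := fun i => D i (x, 0) / (i.factorial : ℝ))
      (b := ‖x‖ + 1) (c := c₀) (q := q) (by positivity) (by linarith) hc₀.le ?_ ?_ hi
    · intro t ht
      rw [← hexp x t ht, add_right_comm]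
      exact hgr x t ht
    · exact hk₁.trans_le (by exact_mod_cast hki)
  have hlap : ∀ i x, lap n (fun x => D i (x, 0) / (i.factorial : ℝ)) x =
      ((i : ℝ) + 1) * (D (i + 1) (x, 0) / ((i + 1).factorial : ℝ)) := by
    intro i x
    rw [lap_div_const _ (hslice i), lap_slice (hDheat i).1, (hDheat i).sum_dirDeriv le_rfl,
      Nat.factorial_succ]
    have : (i.factorial : ℝ) ≠ 0 := by positivity
    have : (i : ℝ) + 1 ≠ 0 := by positivity
    simp only [hD, Function.iterate_succ_apply']
    push_cast
    field_simp
  refine ⟨fun i x => D i (x, 0) / (i.factorial : ℝ), fun i => (hslice i).div_const _,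
    fun x t ht => ?_, fun i _ x => hlap i x, fun x => ?_⟩
  · rw [hexp x t ht]
    refine (Finset.sum_subset (Finset.range_mono (by omega)) fun i hi hik => ?_).symm
    rw [hzero x i (by simpa using hik) (by simpa using hi), zero_mul]
  · rw [hlap, Nat.sub_add_cancel hk, hzero x k le_rfl (by omega), mul_zero]
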